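/- arXiv:2405.15986 — 5 statements merged into one kernel-verified Lean document; each statement's English description precedes it below -/
import Mathlib

section
/- Let d ≥ 1, h > 0, and let z, Δ : [0,h] → ℝ^d be continuous with z(0) = 0 and z(τ) = ∫₀^τ ( (1/2) z(τ') + Δ(τ') ) dτ' for all τ ∈ [0,h]. Then for every τ ∈ [0,h], ‖z(τ)‖² ≤ e^{2τ} ∫₀^τ ‖Δ(τ')‖² dτ'. -/
open MeasureTheory Set

/-- The fundamental theorem of calculus at interior points, for an integrand that is
continuous on a closed interval only. -/
theorem hasDerivAt_integral_of_continuousOn_Icc {E : Type*} [NormedAddCommGroup E]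
    [NormedSpace ℝ E] [CompleteSpace E] {f : ℝ → E} {a b t : ℝ}
    (hf : ContinuousOn f (Icc a b)) (ht : t ∈ Ioo a b) :
    HasDerivAt (fun u => ∫ s in a..u, f s) (f t) t := by
  have hint : IntervalIntegrable f volume a t :=
    (hf.mono (Icc_subset_Icc_right ht.2.le)).intervalIntegrable_of_Icc ht.1.le
  refine intervalIntegral.integral_hasDerivAt_right hint ?_
    (hf.continuousAt (Icc_mem_nhds ht.1 ht.2))
  exact (hf.mono Ioo_subset_Icc_self).stronglyMeasurableAtFilter isOpen_Ioo t ht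

/-- Grönwall-type bound for the integral equation `z(t) = ∫₀ᵗ (z / 2 + Δ)` in a Hilbert space. -/
theorem norm_sq_le_exp_mul_integral_norm_sq {E : Type*} [NormedAddCommGroup E]
    [InnerProductSpace ℝ E] [CompleteSpace E] {h : ℝ} {z Δ : ℝ → E}
    (hz_cont : ContinuousOn z (Icc 0 h)) (hΔ_cont : ContinuousOn Δ (Icc 0 h))
    (hz_eq : ∀ t ∈ Icc (0 : ℝ) h, z t = ∫ s in (0 : ℝ)..t, ((1 / 2 : ℝ) • z s + Δ s))
    {t : ℝ} (ht : t ∈ Icc (0 : ℝ) h) :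
    ‖z t‖ ^ 2 ≤ Real.exp (2 * t) * ∫ s in (0 : ℝ)..t, ‖Δ s‖ ^ 2 := by
  have hh : (0 : ℝ) ≤ h := ht.1.trans ht.2
  have hz0 : z 0 = 0 := by simpa using hz_eq 0 ⟨le_rfl, hh⟩
  have hz_deriv : ∀ s ∈ Ioo 0 h, HasDerivAt z ((1 / 2 : ℝ) • z s + Δ s) s := fun s hs =>
    (hasDerivAt_integral_of_continuousOn_Icc
      ((hz_cont.const_smul (1 / 2 : ℝ)).add hΔ_cont) hs).congr_of_eventuallyEq <| by
        filter_upwards [Icc_mem_nhds hs.1 hs.2] with u hu using hz_eq u hu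
  have hΔ_sq : ContinuousOn (fun s => ‖Δ s‖ ^ 2) (Icc 0 h) := hΔ_cont.norm.pow 2
  have hI_cont : ContinuousOn (fun u => ∫ s in (0 : ℝ)..u, ‖Δ s‖ ^ 2) (Icc 0 h) :=
    intervalIntegral.continuousOn_primitive_interval
      (by rw [uIcc_of_le hh]; exact hΔ_sq.integrableOn_Icc) |>.mono (uIcc_of_le hh).ge
  have hanti : AntitoneOn
      (fun u => Real.exp (-(2 * u)) * ‖z u‖ ^ 2 - ∫ s in (0 : ℝ)..u, ‖Δ s‖ ^ 2) (Icc 0 h) := by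
    refine antitoneOn_of_hasDerivWithinAt_nonpos (convex_Icc 0 h)
      (f' := fun s => Real.exp (-(2 * s)) * -2 * ‖z s‖ ^ 2
        + Real.exp (-(2 * s)) * (2 * inner ℝ (z s) ((1 / 2 : ℝ) • z s + Δ s)) - ‖Δ s‖ ^ 2)
      ?_ ?_ ?_
    · exact (ContinuousOn.mul (by fun_prop) (hz_cont.norm.pow 2)).sub hI_cont
    · intro s hs
      rw [interior_Icc] at hs
      have hexp : HasDerivAt (fun u : ℝ => Real.exp (-(2 * u)))
          (Real.exp (-(2 * s)) * -2) s := by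
        simpa using ((hasDerivAt_id s).const_mul (2 : ℝ)).neg.exp
      exact ((hexp.mul (hz_deriv s hs).norm_sq).sub
        (hasDerivAt_integral_of_continuousOn_Icc hΔ_sq hs)).hasDerivWithinAt
    · intro s hs
      rw [interior_Icc] at hs
      have hinner : inner ℝ (z s) (Δ s) ≤ ‖z s‖ * ‖Δ s‖ := real_inner_le_norm _ _
      have hexp : Real.exp (-(2 * s)) ≤ 1 := Real.exp_le_one_iff.2 (by linarith [hs.1])
      have hdiss : -2 * ‖z s‖ ^ 2 + 2 * inner ℝ (z s) ((1 / 2 : ℝ) • z s + Δ s)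
          ≤ ‖Δ s‖ ^ 2 := by
        rw [inner_add_right, real_inner_smul_right, real_inner_self_eq_norm_sq]
        nlinarith [sq_nonneg (‖z s‖ - ‖Δ s‖)]
      have := mul_le_mul_of_nonneg_left hdiss (Real.exp_pos (-(2 * s))).le
      have := mul_le_mul_of_nonneg_right hexp (sq_nonneg ‖Δ s‖)
      linarith
  have hle : Real.exp (-(2 * t)) * ‖z t‖ ^ 2 ≤ ∫ s in (0 : ℝ)..t, ‖Δ s‖ ^ 2 := by
    simpa [hz0] using hanti ⟨le_rfl, hh⟩ ht ht.1
  rwa [Real.exp_neg, inv_mul_le_iff₀ (Real.exp_pos _)] at hle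

/-- Grönwall-type estimate: if `z(0) = 0` and
`z(τ) = ∫₀^τ ((1/2) z(τ') + Δ(τ')) dτ'` on `[0, h]`, then
`‖z(τ)‖² ≤ e^{2τ} ∫₀^τ ‖Δ(τ')‖² dτ'`. -/
theorem stmt_4
    (d : ℕ) (hd : 1 ≤ d) (h : ℝ) (hh : 0 < h)
    (z Δ : ℝ → EuclideanSpace ℝ (Fin d))
    (hz_cont : ContinuousOn z (Set.Icc 0 h))
    (hΔ_cont : ContinuousOn Δ (Set.Icc 0 h))
    (hz0 : z 0 = 0)
    (hz_eq : ∀ t ∈ Set.Icc (0 : ℝ) h,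
      z t = ∫ t' in (0 : ℝ)..t, ((1 / 2 : ℝ) • z t' + Δ t')) :
    ∀ t ∈ Set.Icc (0 : ℝ) h,
      ‖z t‖ ^ 2 ≤ Real.exp (2 * t) * ∫ t' in (0 : ℝ)..t, ‖Δ t'‖ ^ 2 := by
  exact fun t ht => norm_sq_le_exp_mul_integral_norm_sq hz_cont hΔ_cont hz_eq ht
end

section
/- Let d ≥ 1, h > 0, let 0 = τ₀ < τ₁ < ⋯ < τ_M = h be a partition of [0,h] and let g : [0,h] → [0,h] be the rounding map with g(τ) = τ_j for τ ∈ [τ_j, τ_{j+1}). Let L ≥ 0 and for each grid point τ_j let s_{τ_j} : ℝ^d → ℝ^d be L-Lipschitz. Let y⁰, y¹, y² : [0,h] → ℝ^d be continuous functions with y²(0) = y¹(0) such that for all τ ∈ [0,h], y²(τ) − y¹(τ) = ∫₀^τ [ (1/2)(y²(τ') − y¹(τ')) + s_{g(τ')}(y¹(g(τ'))) − s_{g(τ')}(y⁰(g(τ'))) ] dτ'. Then for every τ ∈ [0,h], ‖y²(τ) − y¹(τ)‖² ≤ L² e^{2τ} ∫₀^τ ‖y¹(g(τ')) − y⁰(g(τ'))‖²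 dτ'. -/
open MeasureTheory Set

/-- Cells of a partition cover the half-open interval between its endpoints. -/
theorem exists_mem_Ico_of_partition (τ : ℕ → ℝ) (M : ℕ) {t : ℝ} (ht : t ∈ Ico (τ 0) (τ M)) :
    ∃ j < M, t ∈ Ico (τ j) (τ (j + 1)) := by
  induction M with
  | zero => exact absurd (ht.1.trans_lt ht.2) (lt_irrefl _)
  | succ n ih =>
    by_cases hn : t < τ n
    · obtain ⟨j, hj, hjt⟩ := ih ⟨ht.1, hn⟩
      exact ⟨j, hj.trans n.lt_succ_self, hjt⟩
    · exact ⟨n, n.lt_succ_self, not_lt.1 hn, ht.2⟩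

/-- A function that is constant on each cell of a partition is interval integrable. -/
theorem intervalIntegrable_of_const_on_partition {E : Type*} [NormedAddCommGroup E]
    (τ : ℕ → ℝ) (M : ℕ) (hτ : ∀ j < M, τ j < τ (j + 1)) (f : ℝ → E)
    (hf : ∀ j < M, ∀ t ∈ Ico (τ j) (τ (j + 1)), f t = f (τ j)) :
    IntervalIntegrable f volume (τ 0) (τ M) := by
  refine IntervalIntegrable.trans_iterate fun j hj => ?_
  rw [intervalIntegrable_iff_integrableOn_Ico_of_le (hτ j hj).le]
  exact (integrableOn_const (C := f (τ j)) (by simp)).congr_fun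
    (fun t ht => (hf j hj t ht).symm) measurableSet_Ico

/-- A function that is constant on each cell of a partition is right-continuous. -/
theorem continuousWithinAt_Ioi_of_const_on_partition {E : Type*} [TopologicalSpace E]
    (τ : ℕ → ℝ) (M : ℕ) (f : ℝ → E)
    (hf : ∀ j < M, ∀ t ∈ Ico (τ j) (τ (j + 1)), f t = f (τ j))
    {t : ℝ} (ht : t ∈ Ico (τ 0) (τ M)) : ContinuousWithinAt f (Ioi t) t := by
  obtain ⟨j, hj, hjt⟩ := exists_mem_Ico_of_partition τ M ht
  refine (continuousWithinAt_const (b := f (τ j))).congr_of_eventuallyEq ?_ (hf j hj t hjt)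
  filter_upwards [Ioo_mem_nhdsGT hjt.2] with x hx
  exact hf j hj x ⟨hjt.1.trans hx.1.le, hx.2⟩

/-- Right derivative of the primitive of an integrable, right-continuous function. -/
theorem hasDerivWithinAt_Ici_integral {E : Type*} [NormedAddCommGroup E] [NormedSpace ℝ E]
    [CompleteSpace E] {f : ℝ → E} {a b t : ℝ} (hf : IntervalIntegrable f volume a b)
    (ht : t ∈ Ico a b) (hc : ContinuousWithinAt f (Ioi t) t) :
    HasDerivWithinAt (fun x => ∫ r in a..x, f r) (f t) (Ici t) t := by
  have hab : a ≤ b := ht.1.trans ht.2.le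
  refine intervalIntegral.integral_hasDerivWithinAt_right (t := Ioi t) ?_ ?_ hc
  · refine hf.mono_set ?_
    rw [uIcc_of_le ht.1, uIcc_of_le hab]
    exact Icc_subset_Icc_right ht.2.le
  · refine ⟨Ioc t b, Ioc_mem_nhdsGT ht.2, ?_⟩
    exact (hf.1.mono_set (Ioc_subset_Ioc_left ht.1)).aestronglyMeasurable

/-- Energy estimate for `u' = u / 2 + f` in the sense of right derivatives. -/
theorem norm_sq_le_exp_mul_integral {E : Type*} [NormedAddCommGroup E] [InnerProductSpace ℝ E]
    {u f : ℝ → E} {B b : ℝ → ℝ} {h : ℝ} (hu : ContinuousOn u (Icc 0 h))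
    (hu0 : u 0 = 0)
    (hu' : ∀ t ∈ Ico 0 h, HasDerivWithinAt u ((1 / 2 : ℝ) • u t + f t) (Ici t) t)
    (hB : ContinuousOn B (Icc 0 h)) (hB0 : B 0 = 0)
    (hB' : ∀ t ∈ Ico 0 h, HasDerivWithinAt B (b t) (Ici t) t)
    (hfb : ∀ t ∈ Ico 0 h, ‖f t‖ ^ 2 ≤ b t) :
    ∀ t ∈ Icc 0 h, ‖u t‖ ^ 2 ≤ Real.exp (2 * t) * B t := by
  have hexp (t : ℝ) :
      HasDerivAt (fun x : ℝ => Real.exp (-(2 * x))) (Real.exp (-(2 * t)) * -(2 * 1)) t :=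
    ((hasDerivAt_id t).const_mul 2).neg.exp
  have key : ∀ t ∈ Icc 0 h, Real.exp (-(2 * t)) * ‖u t‖ ^ 2 ≤ B t := by
    refine image_le_of_deriv_right_le_deriv_boundary
      (ContinuousOn.mul (by fun_prop) (hu.norm.pow 2))
      (fun t ht => (hexp t).hasDerivWithinAt.mul (hu' t ht).norm_sq)
      (by simp [hu0, hB0]) hB hB' fun t ht => ?_
    have he : Real.exp (-(2 * t)) ≤ 1 := Real.exp_le_one_iff.2 (by linarith [ht.1])
    have hin : 2 * inner ℝ (u t) (f t) ≤ ‖u t‖ ^ 2 + ‖f t‖ ^ 2 := by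
      nlinarith [real_inner_le_norm (u t) (f t), sq_nonneg (‖u t‖ - ‖f t‖)]
    rw [inner_add_right, real_inner_smul_right, real_inner_self_eq_norm_sq, Pi.pow_apply]
    refine le_trans ?_ (hfb t ht)
    nlinarith [mul_le_mul_of_nonneg_left hin (Real.exp_pos (-(2 * t))).le,
      mul_le_mul_of_nonneg_right he (sq_nonneg ‖f t‖)]
  intro t ht
  have := mul_le_mul_of_nonneg_left (key t ht) (Real.exp_pos (2 * t)).le
  rwa [← mul_assoc, ← Real.exp_add, add_neg_cancel, Real.exp_zero, one_mul] at this

/-- Single-step contraction inequality for Picard iteration with grid-frozen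
`L`-Lipschitz score maps: if
`y²(τ) - y¹(τ) = ∫₀^τ [(1/2)(y² - y¹)(τ') + s_{g(τ')}(y¹(g(τ'))) - s_{g(τ')}(y⁰(g(τ')))] dτ'`,
then `‖y²(τ) - y¹(τ)‖² ≤ L² e^{2τ} ∫₀^τ ‖y¹(g(τ')) - y⁰(g(τ'))‖² dτ'`. -/
theorem stmt_5
    (d : ℕ) (hd : 1 ≤ d) (h : ℝ) (hh : 0 < h) (M : ℕ) (hM : 1 ≤ M)
    (τ : ℕ → ℝ) (hτ0 : τ 0 = 0) (hτM : τ M = h)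
    (hτmono : ∀ j < M, τ j < τ (j + 1))
    (g : ℝ → ℝ)
    (hg : ∀ j < M, ∀ t ∈ Set.Ico (τ j) (τ (j + 1)), g t = τ j)
    (hgh : g h = h)
    (L : ℝ) (hL : 0 ≤ L)
    (s : ℝ → EuclideanSpace ℝ (Fin d) → EuclideanSpace ℝ (Fin d))
    (hs_lip : ∀ j ≤ M, ∀ x y : EuclideanSpace ℝ (Fin d),
      ‖s (τ j) x - s (τ j) y‖ ≤ L * ‖x - y‖)
    (y0 y1 y2 : ℝ → EuclideanSpace ℝ (Fin d))
    (hy0_cont : ContinuousOn y0 (Set.Icc 0 h))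
    (hy1_cont : ContinuousOn y1 (Set.Icc 0 h))
    (hy2_cont : ContinuousOn y2 (Set.Icc 0 h))
    (hinit : y2 0 = y1 0)
    (heq : ∀ t ∈ Set.Icc (0 : ℝ) h,
      y2 t - y1 t = ∫ t' in (0 : ℝ)..t,
        ((1 / 2 : ℝ) • (y2 t' - y1 t') + s (g t') (y1 (g t')) - s (g t') (y0 (g t')))) :
    ∀ t ∈ Set.Icc (0 : ℝ) h,
      ‖y2 t - y1 t‖ ^ 2 ≤ L ^ 2 * Real.exp (2 * t) *
        ∫ t' in (0 : ℝ)..t, ‖y1 (g t') - y0 (g t')‖ ^ 2 := by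
  have hconst {E : Type} (F : ℝ → E) :
      ∀ j < M, ∀ t ∈ Ico (τ j) (τ (j + 1)), F (g t) = F (g (τ j)) := fun j hj t ht => by
    rw [hg j hj t ht, hg j hj (τ j) ⟨le_rfl, hτmono j hj⟩]
  have hint {E : Type} [NormedAddCommGroup E] (F : ℝ → E) :
      IntervalIntegrable (fun t => F (g t)) volume 0 h := by
    simpa only [hτ0, hτM] using
      intervalIntegrable_of_const_on_partition τ M hτmono (fun t => F (g t)) (hconst F)
  have hrc {E : Type} [TopologicalSpace E] (F : ℝ → E) {t : ℝ} (ht : t ∈ Ico 0 h) :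
      ContinuousWithinAt (fun t => F (g t)) (Ioi t) t :=
    continuousWithinAt_Ioi_of_const_on_partition τ M (fun t => F (g t)) (hconst F)
      (by rwa [hτ0, hτM])
  set f : ℝ → EuclideanSpace ℝ (Fin d) := fun r => s r (y1 r) - s r (y0 r) with hf
  set a : ℝ → ℝ := fun r => ‖y1 r - y0 r‖ ^ 2 with ha
  have hu : ContinuousOn (fun t => y2 t - y1 t) (Icc 0 h) := hy2_cont.sub hy1_cont
  have hhalf : ContinuousOn (fun t => (1 / 2 : ℝ) • (y2 t - y1 t)) (Icc 0 h) :=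
    hu.const_smul (1 / 2 : ℝ)
  have hIint : IntervalIntegrable (fun t => (1 / 2 : ℝ) • (y2 t - y1 t) + f (g t)) volume 0 h :=
    (hhalf.intervalIntegrable_of_Icc hh.le).add (hint f)
  have hu' : ∀ t ∈ Ico 0 h, HasDerivWithinAt (fun t => y2 t - y1 t)
      ((1 / 2 : ℝ) • (y2 t - y1 t) + f (g t)) (Ici t) t := by
    intro t ht
    have hhalf_right : ContinuousWithinAt (fun t => (1 / 2 : ℝ) • (y2 t - y1 t)) (Ioi t) t :=
      (hhalf t ⟨ht.1, ht.2.le⟩).mono_of_mem_nhdsWithin <|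
        Filter.mem_of_superset (Ioo_mem_nhdsGT ht.2)
          fun x hx => ⟨ht.1.trans hx.1.le, hx.2.le⟩
    refine (hasDerivWithinAt_Ici_integral hIint ht
      (hhalf_right.add (hrc f ht))).congr_of_eventuallyEq_of_mem ?_ self_mem_Ici
    filter_upwards [Ico_mem_nhdsGE ht.2] with x hx
    rw [heq x ⟨ht.1.trans hx.1, hx.2.le⟩]
    simp only [hf, add_sub_assoc]
  have hB : ContinuousOn (fun t => L ^ 2 * ∫ r in (0 : ℝ)..t, a (g r)) (Icc 0 h) := by
    have := intervalIntegral.continuousOn_primitive_interval' (hint a) left_mem_uIcc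
    rw [uIcc_of_le hh.le] at this
    exact this.const_mul (L ^ 2)
  have hfb : ∀ t ∈ Ico 0 h, ‖f (g t)‖ ^ 2 ≤ L ^ 2 * a (g t) := by
    intro t ht
    obtain ⟨j, hj, hjt⟩ := exists_mem_Ico_of_partition τ M (by rwa [hτ0, hτM])
    rw [hg j hj t hjt, ha, ← mul_pow]
    exact pow_le_pow_left₀ (norm_nonneg _) (hs_lip j hj.le _ _) 2
  intro t ht
  have := norm_sq_le_exp_mul_integral (f := fun t => f (g t)) hu (by simp [hinit]) hu' hB
    (by simp) (fun t ht => (hasDerivWithinAt_Ici_integral (hint a) ht (hrc a ht)).const_mul _)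
    hfb t ht
  linarith
end

section
/- Let d ≥ 1, h > 0, let 0 = τ₀ < τ₁ < ⋯ < τ_M = h be a partition of [0,h] and let g : [0,h] → [0,h] be the rounding map with g(τ) = τ_j for τ ∈ [τ_j, τ_{j+1}). Let L ≥ 0, for each grid point τ_j let s_{τ_j} : ℝ^d → ℝ^d be L-Lipschitz, let y₀ ∈ ℝ^d, let w : [0,h] → ℝ^d be a continuous function with w(0) = 0, and let K ≥ 2. Suppose y^{(0)}, …, y^{(K)} : [0,h] → ℝ^d are continuous, y^{(0)}(τ) = y₀ for all τ, and for every k ∈ {0, …, K−1} and τ ∈ [0,h], y^{(k+1)}(τ) = y₀ + ∫₀^τ [ (1/2) y^{(k+1)}(τ') + s_{g(τ')}(y^{(k)}(g(τ'))) ] dτ' + w(τ). Then for every k ∈ {1, …, K−1}, sup_{τ∈[0,h]} ‖y^{(k+1)}(τ) − y^{(k)}(τ)‖² ≤ (L² h e^{2h})^k · sup_{τ∈[0,h]} ‖y^{(1)}(τ) − y^{(0)}(τ)‖². -/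
open MeasureTheory Set

/-- Integral form of Grönwall's inequality for a continuous function starting from zero. -/
theorem norm_le_gronwallBound_of_norm_le_integral {E : Type*} [NormedAddCommGroup E]
    {z : ℝ → E} {h a b : ℝ} (hh : 0 ≤ h) (ha : 0 ≤ a) (hb : 0 ≤ b)
    (hz : ContinuousOn z (Icc 0 h))
    (hle : ∀ t ∈ Icc (0 : ℝ) h, ‖z t‖ ≤ ∫ x in (0 : ℝ)..t, (a * ‖z x‖ + b)) :
    ∀ t ∈ Icc (0 : ℝ) h, ‖z t‖ ≤ gronwallBound 0 a b t := by
  let v : ℝ → ℝ := IccExtend hh ((Icc 0 h).domRestrict fun x => a * ‖z x‖ + b)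
  have hv : Continuous v :=
    ((continuousOn_const.mul hz.norm).add continuousOn_const).domRestrict.Icc_extend'
  have hv_eq : ∀ t ∈ Icc (0 : ℝ) h, v t = a * ‖z t‖ + b := fun t ht =>
    IccExtend_of_mem hh _ ht
  have hv_nonneg : ∀ t, 0 ≤ v t := fun t => by
    have : 0 ≤ a * ‖z (projIcc 0 h hh t)‖ + b := by positivity
    exact this
  have hφ : ∀ t ∈ Icc (0 : ℝ) h, ‖z t‖ ≤ ∫ x in (0 : ℝ)..t, v x := fun t ht => by
    refine (hle t ht).trans_eq (intervalIntegral.integral_congr fun x hx => ?_)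
    rw [uIcc_of_le ht.1] at hx
    exact (hv_eq x ⟨hx.1, hx.2.trans ht.2⟩).symm
  have hd : ∀ t, HasDerivAt (fun u => ∫ x in (0 : ℝ)..u, v x) (v t) t := fun t =>
    hv.integral_hasStrictDerivAt 0 t |>.hasDerivAt
  intro t ht
  have key := norm_le_gronwallBound_of_norm_deriv_right_le
    (f := fun u => ∫ x in (0 : ℝ)..u, v x) (f' := v) (δ := 0) (K := a) (ε := b) (a := 0) (b := h)
    (fun t _ => (hd t).continuousAt.continuousWithinAt)
    (fun t _ => (hd t).hasDerivWithinAt) (by simp)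
    (fun t ht => by
      have ht' := Ico_subset_Icc_self ht
      rw [Real.norm_of_nonneg (hv_nonneg t), hv_eq t ht']
      gcongr
      exact (hφ t ht').trans (le_abs_self _)) t ht
  rw [sub_zero] at key
  exact (hφ t ht).trans ((le_abs_self _).trans key)

/-- Grönwall's bound with rate `1 / 2` and forcing `b` has square at most `b² h e^{2h}` on `[0, h]`. -/
theorem gronwallBound_half_sq_le {h b t : ℝ} (ht : t ∈ Icc 0 h) :
    gronwallBound 0 (1 / 2) b t ^ 2 ≤ b ^ 2 * (h * Real.exp (2 * h)) := by
  have hh : 0 ≤ h := ht.1.trans ht.2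
  rw [gronwallBound_of_K_ne_0 (by norm_num)]
  have h1 : Real.exp (1 / 2 * t) - 1 ≤ h / 2 * Real.exp (h / 2) := by
    have hmono : Real.exp (1 / 2 * t) ≤ Real.exp (h / 2) :=
      Real.exp_le_exp.2 (by linarith [ht.2])
    have hneg := Real.add_one_le_exp (-(h / 2))
    have hmul : Real.exp (-(h / 2)) * Real.exp (h / 2) = 1 := by
      rw [← Real.exp_add]; simp
    nlinarith [Real.exp_pos (h / 2)]
  have h0 : 0 ≤ Real.exp (1 / 2 * t) - 1 := by
    have := Real.one_le_exp (x := 1 / 2 * t) (by linarith [ht.1])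
    linarith
  have h2 : (2 * (Real.exp (1 / 2 * t) - 1)) ^ 2 ≤ h * Real.exp (2 * h) := by
    calc (2 * (Real.exp (1 / 2 * t) - 1)) ^ 2
        ≤ (2 * (h / 2 * Real.exp (h / 2))) ^ 2 := by gcongr
      _ = h * (h * (Real.exp (h / 2) * Real.exp (h / 2))) := by ring
      _ = h * (h * Real.exp h) := by rw [← Real.exp_add, add_halves]
      _ ≤ h * (Real.exp h * Real.exp h) := by
          gcongr
          linarith [Real.add_one_le_exp h]
      _ = h * Real.exp (2 * h) := by rw [← Real.exp_add, two_mul]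
  calc (0 * Real.exp (1 / 2 * t) + b / (1 / 2) * (Real.exp (1 / 2 * t) - 1)) ^ 2
      = b ^ 2 * (2 * (Real.exp (1 / 2 * t) - 1)) ^ 2 := by ring
    _ ≤ b ^ 2 * (h * Real.exp (2 * h)) := by gcongr

/-- If `z` solves `z' = z / 2 + δ` in integral form, `z 0 = 0` and `‖δ‖ ≤ b` on `[0, h)`,
then `‖z‖² ≤ b² h e^{2h}` on `[0, h]`. -/
theorem norm_sq_le_of_eq_integral_half_smul_add {E : Type*} [NormedAddCommGroup E]
    [NormedSpace ℝ E] {z δ : ℝ → E} {h b : ℝ} (hh : 0 ≤ h) (hb : 0 ≤ b)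
    (hz : ContinuousOn z (Icc 0 h))
    (hδ : ∀ t ∈ Ico 0 h, ‖δ t‖ ≤ b)
    (heq : ∀ t ∈ Icc (0 : ℝ) h, z t = ∫ x in (0 : ℝ)..t, ((1 / 2 : ℝ) • z x + δ x)) :
    ∀ t ∈ Icc (0 : ℝ) h, ‖z t‖ ^ 2 ≤ b ^ 2 * (h * Real.exp (2 * h)) := by
  intro t ht
  refine le_trans ?_ (gronwallBound_half_sq_le ht)
  gcongr
  refine norm_le_gronwallBound_of_norm_le_integral hh (by norm_num) hb hz (fun u hu => ?_) t ht
  rw [heq u hu]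
  refine intervalIntegral.norm_integral_le_of_norm_le hu.1 ?_ ?_
  · have hne : ∀ᵐ x : ℝ, x ≠ u := by simp [ae_iff]
    filter_upwards [hne] with x hxu hx
    refine (norm_add_le _ _).trans (add_le_add ?_ (hδ x ⟨hx.1.le, ?_⟩))
    · rw [norm_smul, Real.norm_of_nonneg (by norm_num)]
    · exact (lt_of_le_of_ne hx.2 hxu).trans_le hu.2
  · refine ContinuousOn.intervalIntegrable_of_Icc hu.1 ?_
    exact ((continuousOn_const.mul hz.norm).add continuousOn_const).mono
      (Icc_subset_Icc_right hu.2)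

/-- A function that is constant on each cell of a finite partition is interval integrable. -/
theorem intervalIntegrable_of_eq_const_on_cells {E : Type*} [NormedAddCommGroup E]
    {τ : ℕ → ℝ} {M : ℕ} (hτ : ∀ j < M, τ j ≤ τ (j + 1)) {f : ℝ → E} (c : ℕ → E)
    (hf : ∀ j < M, ∀ t ∈ Ico (τ j) (τ (j + 1)), f t = c j) :
    IntervalIntegrable f volume (τ 0) (τ M) := by
  refine IntervalIntegrable.trans_iterate fun j hj => ?_
  refine (intervalIntegrable_const (c := c j)).congr_uIoo fun t ht => ?_
  rw [uIoo_of_le (hτ j hj)] at ht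
  exact (hf j hj t (Ioo_subset_Ico_self ht)).symm

/-- The cells of a partition `τ 0, …, τ M` cover `[τ 0, τ M)`. -/
theorem exists_mem_Ico_of_mem_Ico {τ : ℕ → ℝ} {M : ℕ} {t : ℝ} (ht : t ∈ Ico (τ 0) (τ M)) :
    ∃ j < M, t ∈ Ico (τ j) (τ (j + 1)) := by
  induction M with
  | zero => exact absurd ht.2 (not_lt.2 ht.1)
  | succ n ih =>
    by_cases hn : t < τ n
    · obtain ⟨j, hj, hjt⟩ := ih ⟨ht.1, hn⟩
      exact ⟨j, hj.trans n.lt_succ_self, hjt⟩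
    · exact ⟨n, n.lt_succ_self, not_lt.1 hn, ht.2⟩

/-- Exponential (geometric) convergence of Picard iteration within one block of the
SDE implementation: all iterates are driven by the same path `w`, so for
`1 ≤ k ≤ K - 1`,
`sup_τ ‖y⁽ᵏ⁺¹⁾(τ) - y⁽ᵏ⁾(τ)‖² ≤ (L² h e^{2h})^k · sup_τ ‖y⁽¹⁾(τ) - y⁽⁰⁾(τ)‖²`
(the left-hand supremum bound is stated pointwise in `τ`). -/
theorem stmt_6
    (d : ℕ) (hd : 1 ≤ d) (h : ℝ) (hh : 0 < h) (M : ℕ) (hM : 1 ≤ M)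
    (τ : ℕ → ℝ) (hτ0 : τ 0 = 0) (hτM : τ M = h)
    (hτmono : ∀ j < M, τ j < τ (j + 1))
    (g : ℝ → ℝ)
    (hg : ∀ j < M, ∀ t ∈ Set.Ico (τ j) (τ (j + 1)), g t = τ j)
    (hgh : g h = h)
    (L : ℝ) (hL : 0 ≤ L)
    (s : ℝ → EuclideanSpace ℝ (Fin d) → EuclideanSpace ℝ (Fin d))
    (hs_lip : ∀ j ≤ M, ∀ x y : EuclideanSpace ℝ (Fin d),
      ‖s (τ j) x - s (τ j) y‖ ≤ L * ‖x - y‖)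
    (y₀ : EuclideanSpace ℝ (Fin d))
    (w : ℝ → EuclideanSpace ℝ (Fin d))
    (hw_cont : ContinuousOn w (Set.Icc 0 h)) (hw0 : w 0 = 0)
    (K : ℕ) (hK : 2 ≤ K)
    (y : ℕ → ℝ → EuclideanSpace ℝ (Fin d))
    (hy_cont : ∀ k ≤ K, ContinuousOn (y k) (Set.Icc 0 h))
    (hy0 : ∀ t, y 0 t = y₀)
    (hy_eq : ∀ k < K, ∀ t ∈ Set.Icc (0 : ℝ) h,
      y (k + 1) t = y₀ + (∫ t' in (0 : ℝ)..t,
          ((1 / 2 : ℝ) • y (k + 1) t' + s (g t') (y k (g t')))) + w t) :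
    ∀ k : ℕ, 1 ≤ k → k ≤ K - 1 → ∀ t ∈ Set.Icc (0 : ℝ) h,
      ‖y (k + 1) t - y k t‖ ^ 2 ≤ (L ^ 2 * h * Real.exp (2 * h)) ^ k *
        sSup ((fun t => ‖y 1 t - y 0 t‖ ^ 2) '' Set.Icc 0 h) := by
  have hτ_le : ∀ j ≤ M, ∀ i ≤ j, τ i ≤ τ j := by
    intro j hj i hij
    induction j, hij using Nat.le_induction with
    | base => exact le_rfl
    | succ n _ ih => exact (ih (by lia)).trans (hτmono n (by lia)).le
  have hτ_mem : ∀ j ≤ M, τ j ∈ Icc 0 h := fun j hj =>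
    ⟨hτ0 ▸ hτ_le j hj 0 (Nat.zero_le j), hτM ▸ hτ_le M le_rfl j hj⟩
  have hint : ∀ k < K, ∀ t ∈ Icc (0 : ℝ) h, IntervalIntegrable
      (fun t' => (1 / 2 : ℝ) • y (k + 1) t' + s (g t') (y k (g t'))) volume 0 t := by
    intro k hk t ht
    refine IntervalIntegrable.add ?_ ?_
    · exact (((hy_cont (k + 1) hk).mono (Icc_subset_Icc_right ht.2)).const_smul
        (1 / 2 : ℝ)).intervalIntegrable_of_Icc ht.1
    · have := intervalIntegrable_of_eq_const_on_cells (fun j hj => (hτmono j hj).le)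
        (f := fun t' => s (g t') (y k (g t'))) (fun j => s (τ j) (y k (τ j)))
        (fun j hj t ht => by simp only [hg j hj t ht])
      rw [hτ0, hτM] at this
      refine this.mono_set ?_
      rw [uIcc_of_le ht.1, uIcc_of_le hh.le]
      exact Icc_subset_Icc_right ht.2
  have hstep : ∀ k, k + 1 < K → ∀ B : ℝ, 0 ≤ B →
      (∀ t ∈ Icc (0 : ℝ) h, ‖y (k + 1) t - y k t‖ ^ 2 ≤ B) →
      ∀ t ∈ Icc (0 : ℝ) h, ‖y (k + 2) t - y (k + 1) t‖ ^ 2 ≤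
        L ^ 2 * h * Real.exp (2 * h) * B := by
    intro k hk B hB hbound t ht
    have key := norm_sq_le_of_eq_integral_half_smul_add (z := fun t => y (k + 2) t - y (k + 1) t)
      (δ := fun t => s (g t) (y (k + 1) (g t)) - s (g t) (y k (g t)))
      (b := L * √B) hh.le (by positivity)
      ((hy_cont (k + 2) hk).sub (hy_cont (k + 1) hk.le)) ?_ ?_ t ht
    · refine key.trans_eq ?_
      rw [mul_pow, Real.sq_sqrt hB]
      ring
    · intro u hu
      rw [← hτ0, ← hτM] at hu
      obtain ⟨j, hj, hju⟩ := exists_mem_Ico_of_mem_Ico hu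
      simp only [hg j hj u hju]
      refine (hs_lip j hj.le _ _).trans ?_
      gcongr
      exact Real.le_sqrt_of_sq_le (hbound _ (hτ_mem j hj.le))
    · intro u hu
      conv_lhs => rw [hy_eq (k + 1) hk u hu, hy_eq k (by lia) u hu]
      rw [add_sub_add_right_eq_sub, add_sub_add_left_eq_sub,
        ← intervalIntegral.integral_sub (hint (k + 1) hk u hu) (hint k (by lia) u hu)]
      refine intervalIntegral.integral_congr fun x _ => ?_
      simp only [smul_sub]
      abel
  have hbdd : BddAbove ((fun t => ‖y 1 t - y 0 t‖ ^ 2) '' Icc 0 h) :=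
    isCompact_Icc.bddAbove_image
      (((hy_cont 1 (by lia)).sub (hy_cont 0 (by lia))).norm.pow 2)
  have hS : 0 ≤ sSup ((fun t => ‖y 1 t - y 0 t‖ ^ 2) '' Icc 0 h) :=
    Real.sSup_nonneg (by rintro _ ⟨t, _, rfl⟩; positivity)
  have hall : ∀ k, k < K → ∀ t ∈ Icc (0 : ℝ) h,
      ‖y (k + 1) t - y k t‖ ^ 2 ≤ (L ^ 2 * h * Real.exp (2 * h)) ^ k *
        sSup ((fun t => ‖y 1 t - y 0 t‖ ^ 2) '' Icc 0 h) := by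
    intro k
    induction k with
    | zero =>
      intro _ t ht
      rw [pow_zero, one_mul]
      exact le_csSup hbdd (mem_image_of_mem _ ht)
    | succ k ih =>
      intro hk t ht
      rw [pow_succ' (L ^ 2 * h * Real.exp (2 * h)) k, mul_assoc _ (_ ^ k)]
      exact hstep k hk _ (by positivity) (ih (by lia)) t ht
  exact fun k _ hk => hall k (by lia)
end

section
/- Let d ≥ 1, γ > 0, h > 0, and let z, Δ : [0,h] → ℝ^d be continuous with z(0) = 0 and z(τ) = ∫₀^τ ( −γ z(τ') − Δ(τ') ) dτ' for all τ ∈ [0,h]. Then for every τ ∈ [0,h], ‖z(τ)‖² ≤ (1/(2γ)) ∫₀^τ ‖Δ(τ')‖² dτ'. -/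
open MeasureTheory Set

/-- First part of the fundamental theorem of calculus at an interior point, for an integrand
continuous on a compact interval. -/
theorem ContinuousOn.hasDerivAt_integral_of_mem_Ioo {E : Type*} [NormedAddCommGroup E]
    [NormedSpace ℝ E] [CompleteSpace E] {g : ℝ → E} {a b t : ℝ}
    (hg : ContinuousOn g (Icc a b)) (ht : t ∈ Ioo a b) :
    HasDerivAt (fun u => ∫ s in a..u, g s) (g t) t := by
  have hsub : uIcc a t ⊆ Icc a b := by
    rw [uIcc_of_le ht.1.le]
    exact Icc_subset_Icc_right ht.2.le
  exact intervalIntegral.integral_hasDerivAt_right (hg.mono hsub).intervalIntegrable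
    ((hg.mono Ioo_subset_Icc_self).stronglyMeasurableAtFilter isOpen_Ioo t ht)
    (hg.continuousAt (Icc_mem_nhds ht.1 ht.2))

/-- Completing the square: damping absorbs the forcing term. -/
theorem two_mul_inner_neg_smul_sub_le {E : Type*} [NormedAddCommGroup E]
    [InnerProductSpace ℝ E] {γ : ℝ} (hγ : 0 < γ) (x y : E) :
    2 * inner ℝ x ((-γ) • x - y) ≤ 1 / (2 * γ) * ‖y‖ ^ 2 := by
  have hsq : 0 ≤ ‖(2 * γ) • x + y‖ ^ 2 := sq_nonneg _
  rw [norm_add_sq_real, norm_smul, mul_pow, Real.norm_eq_abs, sq_abs, inner_smul_left] at hsq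
  rw [inner_sub_right, inner_smul_right, real_inner_self_eq_norm_sq, one_div_mul_eq_div,
    le_div_iff₀ (by positivity)]
  simp only [conj_trivial] at hsq
  linarith

/-- Dissipativity estimate for the damped integral equation
`z(τ) = ∫₀^τ (-γ z(τ') - Δ(τ')) dτ'` with friction `γ > 0`:
`‖z(τ)‖² ≤ (1/(2γ)) ∫₀^τ ‖Δ(τ')‖² dτ'` on `[0, h]`. -/
theorem stmt_10
    (d : ℕ) (hd : 1 ≤ d) (γ h : ℝ) (hγ : 0 < γ) (hh : 0 < h)
    (z Δ : ℝ → EuclideanSpace ℝ (Fin d))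
    (hz_cont : ContinuousOn z (Set.Icc 0 h))
    (hΔ_cont : ContinuousOn Δ (Set.Icc 0 h))
    (hz0 : z 0 = 0)
    (hz_eq : ∀ t ∈ Set.Icc (0 : ℝ) h,
      z t = ∫ t' in (0 : ℝ)..t, ((-γ) • z t' - Δ t')) :
    ∀ t ∈ Set.Icc (0 : ℝ) h,
      ‖z t‖ ^ 2 ≤ (1 / (2 * γ)) * ∫ t' in (0 : ℝ)..t, ‖Δ t'‖ ^ 2 := by
  set F : ℝ → ℝ := fun t => ‖z t‖ ^ 2 - (1 / (2 * γ)) * ∫ s in (0 : ℝ)..t, ‖Δ s‖ ^ 2 with hF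
  have hΔ_sq : ContinuousOn (fun s => ‖Δ s‖ ^ 2) (Icc 0 h) := hΔ_cont.norm.pow 2
  have hrhs : ContinuousOn (fun s => (-γ) • z s - Δ s) (Icc 0 h) :=
    (hz_cont.const_smul (-γ)).sub hΔ_cont
  have hF_cont : ContinuousOn F (Icc 0 h) := by
    have hint : ContinuousOn (fun t => ∫ s in (0 : ℝ)..t, ‖Δ s‖ ^ 2) (Icc 0 h) := by
      rw [← uIcc_of_le hh.le] at hΔ_sq ⊢
      exact intervalIntegral.continuousOn_primitive_interval hΔ_sq.integrableOn_uIcc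
    exact (hz_cont.norm.pow 2).sub (hint.const_mul _)
  have hF_deriv : ∀ t ∈ interior (Icc 0 h), HasDerivWithinAt F
      (2 * inner ℝ (z t) ((-γ) • z t - Δ t) - 1 / (2 * γ) * ‖Δ t‖ ^ 2)
      (interior (Icc 0 h)) t := by
    intro t ht
    rw [interior_Icc] at ht
    have hz_deriv : HasDerivAt z ((-γ) • z t - Δ t) t :=
      (hrhs.hasDerivAt_integral_of_mem_Ioo ht).congr_of_eventuallyEq <|
        Filter.eventually_of_mem (Icc_mem_nhds ht.1 ht.2) hz_eq
    exact (hz_deriv.norm_sq.sub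
      ((hΔ_sq.hasDerivAt_integral_of_mem_Ioo ht).const_mul _)).hasDerivWithinAt
  have hF_anti : AntitoneOn F (Icc 0 h) :=
    antitoneOn_of_hasDerivWithinAt_nonpos (convex_Icc 0 h) hF_cont hF_deriv fun t _ =>
      sub_nonpos.2 (two_mul_inner_neg_smul_sub_le hγ (z t) (Δ t))
  intro t ht
  have hle : F t ≤ F 0 := hF_anti (left_mem_Icc.2 hh.le) ht ht.1
  have hF0 : F 0 = 0 := by simp [hF, hz0]
  exact sub_nonpos.1 (hle.trans_eq hF0)
end

section
/- Let d ≥ 1, γ > 0, h > 0, let 0 = τ₀ < ⋯ < τ_M = h be a partition of [0,h] with rounding map g(τ) = τ_j for τ ∈ [τ_j, τ_{j+1}), let L ≥ 0, let s : ℝ^d → ℝ^d be L-Lipschitz, let u₀, v₀ ∈ ℝ^d, let W : [0,h] → ℝ^d be continuous with W(0) = 0, and let K ≥ 2. Suppose for each k ∈ {0, …, K} the functions u^{(k)}, v^{(k)} : [0,h] → ℝ^d are continuous, u^{(0)}(τ) = u₀ and v^{(0)}(τ) = v₀ for all τ, and for every k ∈ {0, …, K−1} and τ ∈ [0,h]: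 u^{(k+1)}(τ) = u₀ + ∫₀^τ v^{(k+1)}(τ') dτ' and v^{(k+1)}(τ) = v₀ − ∫₀^τ ( γ v^{(k+1)}(τ') + s(u^{(k)}(g(τ'))) ) dτ' + W(τ). Then for every k ∈ {1, …, K−1}, sup_{τ∈[0,h]} ‖u^{(k+1)}(τ) − u^{(k)}(τ)‖² ≤ (L² h² e^{h} / (2γ))^{k} · sup_{τ∈[0,h]} ‖u^{(1)}(τ) − u^{(0)}(τ)‖². -/
open MeasureTheory Set

/-- Energy estimate for `y' = -γ y + f` with `y 0 = 0` and `‖f t‖ ≤ C t`. -/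
theorem norm_sq_le_of_hasDerivAt_damped {E : Type*} [NormedAddCommGroup E]
    [InnerProductSpace ℝ E] {γ h C : ℝ} (hγ : 0 < γ) {y w : ℝ → E}
    (hy : ContinuousOn y (Icc 0 h)) (hy0 : y 0 = 0)
    (hyw : ∀ t ∈ Ioo 0 h, HasDerivAt y (w t) t)
    (hbound : ∀ t ∈ Ioo 0 h, ‖w t + γ • y t‖ ≤ C * t) {t : ℝ} (ht : t ∈ Icc 0 h) :
    ‖y t‖ ^ 2 ≤ C ^ 2 * t ^ 3 / (6 * γ) := by
  have hderiv : ∀ r ∈ Ioo 0 h, HasDerivAt (fun r => ‖y r‖ ^ 2 - C ^ 2 * r ^ 3 / (6 * γ))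
      (2 * inner ℝ (y r) (w r) - C ^ 2 * (3 * r ^ 2) / (6 * γ)) r := by
    intro r hr
    have h3 : HasDerivAt (fun r : ℝ => r ^ 3) (3 * r ^ 2) r := by
      simpa using hasDerivAt_pow 3 r
    exact (hyw r hr).norm_sq.sub ((h3.const_mul (C ^ 2)).div_const (6 * γ))
  have hanti : AntitoneOn (fun r => ‖y r‖ ^ 2 - C ^ 2 * r ^ 3 / (6 * γ)) (Icc 0 h) := by
    apply antitoneOn_of_deriv_nonpos (convex_Icc 0 h)
    · exact (hy.norm.pow 2).sub (Continuous.continuousOn (by fun_prop))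
    · rw [interior_Icc]
      exact fun r hr => (hderiv r hr).differentiableAt.differentiableWithinAt
    · rw [interior_Icc]
      intro r hr
      rw [(hderiv r hr).deriv]
      have hinner : inner ℝ (y r) (w r)
          = inner ℝ (y r) (w r + γ • y r) - γ * ‖y r‖ ^ 2 := by
        rw [inner_add_right, real_inner_smul_right, real_inner_self_eq_norm_sq]
        ring
      have hcs : inner ℝ (y r) (w r + γ • y r) ≤ ‖y r‖ * (C * r) :=
        (real_inner_le_norm _ _).trans
          (mul_le_mul_of_nonneg_left (hbound r hr) (norm_nonneg _))
      have hsq : 2 * (‖y r‖ * (C * r) - γ * ‖y r‖ ^ 2) - C ^ 2 * (3 * r ^ 2) / (6 * γ)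
          = -((C * r - 2 * γ * ‖y r‖) ^ 2 / (2 * γ)) := by
        field_simp
        ring
      have hpos : 0 ≤ (C * r - 2 * γ * ‖y r‖) ^ 2 / (2 * γ) := by positivity
      linarith
  have := hanti ⟨le_rfl, ht.1.trans ht.2⟩ ht ht.1
  simp only [hy0, norm_zero] at this
  norm_num at this
  exact this

/-- A function that factors through a rounding map is integrable. -/
theorem intervalIntegrable_comp_of_eq_on_Ico {E : Type*} [NormedAddCommGroup E] {M : ℕ}
    {τ : ℕ → ℝ} (hτ : ∀ j < M, τ j < τ (j + 1)) {g : ℝ → ℝ}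
    (hg : ∀ j < M, ∀ t ∈ Ico (τ j) (τ (j + 1)), g t = τ j) (f : ℝ → E) :
    IntervalIntegrable (fun t => f (g t)) volume (τ 0) (τ M) := by
  refine IntervalIntegrable.trans_iterate fun j hj => ?_
  rw [intervalIntegrable_iff_integrableOn_Ico_of_le (hτ j hj).le]
  refine IntegrableOn.congr_fun (f := fun _ => f (τ j)) ?_ ?_ measurableSet_Ico
  · exact integrableOn_const (by simp)
  · intro t ht
    simp only [hg j hj t ht]

/-- A rounding map sends the partitioned interval to itself. -/
theorem mapsTo_Ico_of_eq_on_Ico {M : ℕ} {τ : ℕ → ℝ} (hτ : ∀ j < M, τ j < τ (j + 1))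
    {g : ℝ → ℝ} (hg : ∀ j < M, ∀ t ∈ Ico (τ j) (τ (j + 1)), g t = τ j) :
    MapsTo g (Ico (τ 0) (τ M)) (Icc (τ 0) (τ M)) := by
  induction M with
  | zero => simp [MapsTo]
  | succ n ih =>
    have hn : τ n < τ (n + 1) := hτ n n.lt_succ_self
    have h0n : ∀ m ≤ n, τ 0 ≤ τ m := by
      intro m
      induction m with
      | zero => exact fun _ => le_rfl
      | succ m ihm => exact fun hm => (ihm (by omega)).trans (hτ m (by omega)).le
    intro t ht
    rcases lt_or_ge t (τ n) with htn | htn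
    · have := ih (fun j hj => hτ j (by omega)) (fun j hj => hg j (by omega)) ⟨ht.1, htn⟩
      exact ⟨this.1, this.2.trans hn.le⟩
    · rw [hg n n.lt_succ_self t ⟨htn, ht.2⟩]
      exact ⟨h0n n le_rfl, hn.le⟩

/-- Two damped equations driven by the same path: the difference of the positions is controlled
by the uniform distance of the forces. -/
theorem norm_sq_sub_le_of_damped_integral_eq {E : Type*} [NormedAddCommGroup E]
    [InnerProductSpace ℝ E] [CompleteSpace E] {γ h C : ℝ} (hγ : 0 < γ)
    {u₀ v₀ : E} {W u u' v v' f f' : ℝ → E}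
    (hv : ContinuousOn v (Icc 0 h)) (hv' : ContinuousOn v' (Icc 0 h))
    (hf : IntervalIntegrable f volume 0 h) (hf' : IntervalIntegrable f' volume 0 h)
    (hff' : ∀ t ∈ Icc 0 h, ‖f' t - f t‖ ≤ C)
    (hu_eq : ∀ t ∈ Icc 0 h, u t = u₀ + ∫ r in (0 : ℝ)..t, v r)
    (hu'_eq : ∀ t ∈ Icc 0 h, u' t = u₀ + ∫ r in (0 : ℝ)..t, v' r)
    (hv_eq : ∀ t ∈ Icc 0 h, v t = v₀ - (∫ r in (0 : ℝ)..t, (γ • v r + f r)) + W t)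
    (hv'_eq : ∀ t ∈ Icc 0 h, v' t = v₀ - (∫ r in (0 : ℝ)..t, (γ • v' r + f' r)) + W t)
    {t : ℝ} (ht : t ∈ Icc 0 h) :
    ‖u' t - u t‖ ^ 2 ≤ C ^ 2 * t ^ 3 / (6 * γ) := by
  have hh : 0 ≤ h := ht.1.trans ht.2
  have hsub : ∀ {r}, r ∈ Icc 0 h → uIcc 0 r ⊆ Icc 0 h := fun hr => by
    rw [uIcc_of_le hr.1]
    exact Icc_subset_Icc_right hr.2
  have hint : ∀ {φ : ℝ → E}, ContinuousOn φ (Icc 0 h) → ∀ {r}, r ∈ Icc 0 h →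
      IntervalIntegrable φ volume 0 r :=
    fun hφ _ hr => (hφ.mono (hsub hr)).intervalIntegrable
  have hres : ∀ {φ : ℝ → E}, IntervalIntegrable φ volume 0 h → ∀ {r}, r ∈ Icc 0 h →
      IntervalIntegrable φ volume 0 r :=
    fun hφ _ hr => hφ.mono_set (by rw [uIcc_of_le hh]; exact hsub hr)
  have hw : ContinuousOn (fun r => v' r - v r) (Icc 0 h) := hv'.sub hv
  have hy : ∀ r ∈ Icc 0 h, u' r - u r = ∫ x in (0 : ℝ)..r, (v' x - v x) := by
    intro r hr
    rw [hu_eq r hr, hu'_eq r hr, intervalIntegral.integral_sub (hint hv' hr) (hint hv hr)]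
    abel
  rw [hy t ht]
  refine norm_sq_le_of_hasDerivAt_damped (w := fun r => v' r - v r)
    (y := fun r => ∫ x in (0 : ℝ)..r, (v' x - v x)) hγ ?_ (by simp) ?_ ?_ ht
  · have := intervalIntegral.continuousOn_primitive_interval' (a := 0)
      (hint hw ⟨hh, le_rfl⟩) left_mem_uIcc
    rwa [uIcc_of_le hh] at this
  · intro r hr
    have hr' := Ioo_subset_Icc_self hr
    exact intervalIntegral.integral_hasDerivAt_right (hint hw hr')
      ((hw.mono Ioo_subset_Icc_self).stronglyMeasurableAtFilter isOpen_Ioo r hr)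
      (hw.continuousAt (Icc_mem_nhds hr.1 hr.2))
  · intro r hr
    have hr' := Ioo_subset_Icc_self hr
    have hforce : (v' r - v r) + γ • ∫ x in (0 : ℝ)..r, (v' x - v x)
        = -∫ x in (0 : ℝ)..r, (f' x - f x) := by
      have hγv : IntervalIntegrable (fun x => γ • v x) volume 0 r := (hint hv hr').smul γ
      have hγv' : IntervalIntegrable (fun x => γ • v' x) volume 0 r := (hint hv' hr').smul γ
      rw [hv_eq r hr', hv'_eq r hr',
        intervalIntegral.integral_sub (hint hv' hr') (hint hv hr'),
        intervalIntegral.integral_sub (hres hf' hr') (hres hf hr'),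
        intervalIntegral.integral_add hγv (hres hf hr'),
        intervalIntegral.integral_add hγv' (hres hf' hr'),
        intervalIntegral.integral_smul, intervalIntegral.integral_smul, smul_sub]
      abel
    rw [hforce, norm_neg]
    refine (intervalIntegral.norm_integral_le_of_norm_le_const fun x hx => ?_).trans_eq
      (by rw [sub_zero, abs_of_pos hr.1])
    exact hff' x (hsub hr' (uIoc_subset_uIcc hx))

/-- Exponential (geometric) convergence of Picard iteration for the underdamped
Langevin dynamics in the corrector step: all iterates share the same path `W`, so for
`1 ≤ k ≤ K - 1`,
`sup_τ ‖u⁽ᵏ⁺¹⁾(τ) - u⁽ᵏ⁾(τ)‖² ≤ (L² h² e^h / (2γ))^k · sup_τ ‖u⁽¹⁾(τ) - u⁽⁰⁾(τ)‖²`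
(the left-hand supremum bound is stated pointwise in `τ`). -/
theorem stmt_11
    (d : ℕ) (hd : 1 ≤ d) (γ h : ℝ) (hγ : 0 < γ) (hh : 0 < h)
    (M : ℕ) (hM : 1 ≤ M)
    (τ : ℕ → ℝ) (hτ0 : τ 0 = 0) (hτM : τ M = h)
    (hτmono : ∀ j < M, τ j < τ (j + 1))
    (g : ℝ → ℝ)
    (hg : ∀ j < M, ∀ t ∈ Set.Ico (τ j) (τ (j + 1)), g t = τ j)
    (hgh : g h = h)
    (L : ℝ) (hL : 0 ≤ L)
    (s : EuclideanSpace ℝ (Fin d) → EuclideanSpace ℝ (Fin d))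
    (hs_lip : ∀ x y : EuclideanSpace ℝ (Fin d), ‖s x - s y‖ ≤ L * ‖x - y‖)
    (u₀ v₀ : EuclideanSpace ℝ (Fin d))
    (W : ℝ → EuclideanSpace ℝ (Fin d))
    (hW_cont : ContinuousOn W (Set.Icc 0 h)) (hW0 : W 0 = 0)
    (K : ℕ) (hK : 2 ≤ K)
    (u v : ℕ → ℝ → EuclideanSpace ℝ (Fin d))
    (hu_cont : ∀ k ≤ K, ContinuousOn (u k) (Set.Icc 0 h))
    (hv_cont : ∀ k ≤ K, ContinuousOn (v k) (Set.Icc 0 h))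
    (hu0 : ∀ t, u 0 t = u₀) (hv0 : ∀ t, v 0 t = v₀)
    (hu_eq : ∀ k < K, ∀ t ∈ Set.Icc (0 : ℝ) h,
      u (k + 1) t = u₀ + ∫ t' in (0 : ℝ)..t, v (k + 1) t')
    (hv_eq : ∀ k < K, ∀ t ∈ Set.Icc (0 : ℝ) h,
      v (k + 1) t = v₀ - (∫ t' in (0 : ℝ)..t,
          (γ • v (k + 1) t' + s (u k (g t')))) + W t) :
    ∀ k : ℕ, 1 ≤ k → k ≤ K - 1 → ∀ t ∈ Set.Icc (0 : ℝ) h,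
      ‖u (k + 1) t - u k t‖ ^ 2 ≤ (L ^ 2 * h ^ 2 * Real.exp h / (2 * γ)) ^ k *
        sSup ((fun t => ‖u 1 t - u 0 t‖ ^ 2) '' Set.Icc 0 h) := by
  have hgIcc : ∀ t ∈ Icc 0 h, g t ∈ Icc 0 h := by
    intro t ht
    rcases ht.2.lt_or_eq with hlt | rfl
    · have := mapsTo_Ico_of_eq_on_Ico hτmono hg
      rw [hτ0, hτM] at this
      exact this ⟨ht.1, hlt⟩
    · rwa [hgh]
  have hforce : ∀ k, IntervalIntegrable (fun t => s (u k (g t))) volume 0 h := by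
    intro k
    have := intervalIntegrable_comp_of_eq_on_Ico hτmono hg fun r => s (u k r)
    rwa [hτ0, hτM] at this
  set S := sSup ((fun t => ‖u 1 t - u 0 t‖ ^ 2) '' Set.Icc 0 h)
  set q := L ^ 2 * h ^ 2 * Real.exp h / (2 * γ) with hq
  have hS : ∀ t ∈ Icc 0 h, ‖u 1 t - u 0 t‖ ^ 2 ≤ S := by
    intro t ht
    refine le_csSup (isCompact_Icc.image_of_continuousOn ?_).bddAbove (mem_image_of_mem _ ht)
    exact ((hu_cont 1 (by omega)).sub (hu_cont 0 (by omega))).norm.pow 2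
  have hstep : ∀ k, k + 1 < K → ∀ B : ℝ, (∀ t ∈ Icc 0 h, ‖u (k + 1) t - u k t‖ ^ 2 ≤ B) →
      ∀ t ∈ Icc 0 h, ‖u (k + 2) t - u (k + 1) t‖ ^ 2 ≤ q * B := by
    intro k hk B hB t ht
    have hB0 : 0 ≤ B := (sq_nonneg _).trans (hB t ht)
    have hff' : ∀ r ∈ Icc 0 h, ‖s (u (k + 1) (g r)) - s (u k (g r))‖ ≤ L * √B := fun r hr =>
      (hs_lip _ _).trans
        (mul_le_mul_of_nonneg_left (Real.le_sqrt_of_sq_le (hB _ (hgIcc r hr))) hL)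
    have hpos := norm_sq_sub_le_of_damped_integral_eq hγ (hv_cont (k + 1) (by omega))
      (hv_cont (k + 2) (by omega)) (hforce k) (hforce (k + 1)) hff' (hu_eq k (by omega))
      (hu_eq (k + 1) (by omega)) (hv_eq k (by omega)) (hv_eq (k + 1) (by omega)) ht
    refine hpos.trans ?_
    have hexp : h ≤ Real.exp h := by linarith [Real.add_one_le_exp h]
    have ht3 : t ^ 3 ≤ h ^ 2 * Real.exp h :=
      calc t ^ 3 ≤ h ^ 3 := pow_le_pow_left₀ ht.1 ht.2 3
        _ = h ^ 2 * h := by ring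
        _ ≤ h ^ 2 * Real.exp h := by gcongr
    calc (L * √B) ^ 2 * t ^ 3 / (6 * γ) = L ^ 2 * B * t ^ 3 / (6 * γ) := by
          rw [mul_pow, Real.sq_sqrt hB0]
      _ ≤ L ^ 2 * B * (h ^ 2 * Real.exp h) / (2 * γ) := by
          gcongr
          norm_num
      _ = q * B := by
          rw [hq]
          ring
  have hmain : ∀ k < K, ∀ t ∈ Icc 0 h, ‖u (k + 1) t - u k t‖ ^ 2 ≤ q ^ k * S := by
    intro k
    induction k with
    | zero => simpa using fun _ => hS
    | succ k ih =>
      intro hk t ht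
      rw [pow_succ' q, mul_assoc]
      exact hstep k hk _ (ih (by omega)) t ht
  exact fun k _ hk => hmain k (by omega)
end
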